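/- Let R be a simple left Noetherian ring and dim a Sylvester module rank function on R. Then dim(M) = 0 for every finitely generated left R-module M whose Krull dimension is strictly smaller than the left Krull dimension of R. Consequently, the associated Sylvester matrix rank function rk satisfies rk(x) = 1 for every non-zero-divisor x ∈ R, and R has a unique Sylvester rank function, namely the one induced from its classical left quotient ring Q_l(R). -/

import Mathlib

/-- `KdimLE R α M` means that the (Rentschler–Gabriel) Krull dimension of the left
`R`-module `M` is at most the ordinal `α`: for every descending chain
`f 0 ≥ f 1 ≥ ⋯` of submodules of `M`, for all but finitely many `i` the factor
`f i / f (i+1)` is zero or has Krull dimension at most some `β < α`. -/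
def KdimLE (R : Type) [Ring R] (α : Ordinal) (M : Type) [AddCommGroup M]
    [Module R M] : Prop :=
  ∀ f : ℕ → Submodule R M, Antitone f →
    {i : ℕ | ¬ (Subsingleton (↥(f i) ⧸ (Submodule.comap (f i).subtype (f (i + 1)))) ∨
      ∃ β : Ordinal, ∃ _ : β < α,
        KdimLE R β (↥(f i) ⧸ (Submodule.comap (f i).subtype (f (i + 1)))))}.Finite
termination_by α
decreasing_by assumption

/-- `HasKdim R α M` means that the Krull dimension of the non-zero left `R`-module `M`
is exactly the ordinal `α`. -/
def HasKdim (R : Type) [Ring R] (α : Ordinal) (M : Type) [AddCommGroup M]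
    [Module R M] : Prop :=
  KdimLE R α M ∧ ∀ β : Ordinal, β < α → ¬ KdimLE R β M

/-- A Sylvester module rank function on a ring `R`: it assigns a non-negative real number
to each finitely presented left `R`-module (invariantly under isomorphism) satisfying
(SMod1)-(SMod3). -/
structure SylvesterModuleRank (R : Type) [Ring R] where
  d : (M : Type) → [AddCommGroup M] → [Module R M] → ℝ
  d_nonneg : ∀ (M : Type) [AddCommGroup M] [Module R M],
    Module.FinitePresentation R M → 0 ≤ d M
  d_congr : ∀ (M N : Type) [AddCommGroup M] [Module R M] [AddCommGroup N] [Module R N],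
    Module.FinitePresentation R M → (M ≃ₗ[R] N) → d M = d N
  d_bot : d PUnit = 0
  d_self : d R = 1
  d_add : ∀ (M N : Type) [AddCommGroup M] [Module R M] [AddCommGroup N] [Module R N],
    Module.FinitePresentation R M → Module.FinitePresentation R N →
      d (M × N) = d M + d N
  d_exact : ∀ (M₁ M₂ M₃ : Type) [AddCommGroup M₁] [Module R M₁] [AddCommGroup M₂]
      [Module R M₂] [AddCommGroup M₃] [Module R M₃],
    Module.FinitePresentation R M₁ → Module.FinitePresentation R M₂ →
    Module.FinitePresentation R M₃ →
    ∀ (f : M₁ →ₗ[R] M₂) (g : M₂ →ₗ[R] M₃), Function.Exact f g → Function.Surjective g →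
      d M₃ ≤ d M₂ ∧ d M₂ ≤ d M₁ + d M₃

section KrullDimension

universe u

variable {R : Type} [Ring R]

/-- `IsSmall R α M` means that `M` is zero or has Krull dimension strictly less than `α`. -/
def IsSmall (R : Type) [Ring R] (α : Ordinal.{u}) (M : Type) [AddCommGroup M]
    [Module R M] : Prop :=
  Subsingleton M ∨ ∃ β : Ordinal.{u}, ∃ _ : β < α, KdimLE R β M

/-- The subquotient `A / (A ∩ B)` of a module. -/
abbrev Subquotient {M : Type} [AddCommGroup M] [Module R M] (A B : Submodule R M) : Type :=
  ↥A ⧸ Submodule.comap A.subtype B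

theorem kdimLE_iff {α : Ordinal.{u}} {M : Type} [AddCommGroup M] [Module R M] :
    KdimLE R α M ↔ ∀ f : ℕ → Submodule R M, Antitone f →
      {i : ℕ | ¬ IsSmall R α (Subquotient (f i) (f (i + 1)))}.Finite := by
  rw [KdimLE]; rfl

theorem IsSmall.mono {α β : Ordinal.{u}} (h : α ≤ β) {M : Type} [AddCommGroup M] [Module R M]
    (hM : IsSmall R α M) : IsSmall R β M := by
  rcases hM with hM | ⟨γ, hγ, hM⟩
  · exact Or.inl hM
  · exact Or.inr ⟨γ, hγ.trans_le h, hM⟩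

theorem KdimLE.mono {α β : Ordinal.{u}} (h : α ≤ β) {M : Type} [AddCommGroup M] [Module R M]
    (hM : KdimLE R α M) : KdimLE R β M := by
  rw [kdimLE_iff] at hM ⊢
  exact fun f hf ↦ (hM f hf).subset fun i hi h' ↦ hi (h'.mono h)

theorem kdimLE_of_subsingleton (α : Ordinal.{u}) (M : Type) [AddCommGroup M] [Module R M]
    [Subsingleton M] : KdimLE R α M := by
  rw [kdimLE_iff]
  intro f _
  convert Set.finite_empty
  rw [Set.eq_empty_iff_forall_notMem]
  exact fun i hi ↦ hi (Or.inl inferInstance)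

/-- Exactness in the middle passes to the quotients by a submodule of the middle term. -/
theorem exact_mapQ {A B C : Type} [AddCommGroup A] [Module R A] [AddCommGroup B] [Module R B]
    [AddCommGroup C] [Module R C] {f : A →ₗ[R] B} {g : B →ₗ[R] C} (h : Function.Exact f g)
    (N : Submodule R B) :
    Function.Exact (Submodule.mapQ (N.comap f) N f le_rfl)
      (Submodule.mapQ N (N.map g) g (Submodule.le_comap_map g N)) := by
  intro y
  obtain ⟨y, rfl⟩ := N.mkQ_surjective y
  constructor
  · intro hy
    rw [Submodule.mkQ_apply, Submodule.mapQ_apply, Submodule.Quotient.mk_eq_zero] at hy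
    obtain ⟨n, hn, hny⟩ := hy
    obtain ⟨a, ha⟩ := (h (y - n)).1 (by rw [map_sub, hny, sub_self])
    refine ⟨Submodule.Quotient.mk a, ?_⟩
    rw [Submodule.mapQ_apply, ha, Submodule.mkQ_apply, Submodule.Quotient.eq]
    simpa using hn
  · rintro ⟨a, ha⟩
    obtain ⟨a, rfl⟩ := (N.comap f).mkQ_surjective a
    rw [← ha, Submodule.mkQ_apply, Submodule.mapQ_apply, Submodule.mapQ_apply,
      h.apply_apply_eq_zero, Submodule.Quotient.mk_zero]

/-- Exactness in the middle passes to a submodule of the middle term. -/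
theorem exact_restrict {A B C : Type} [AddCommGroup A] [Module R A] [AddCommGroup B] [Module R B]
    [AddCommGroup C] [Module R C] {f : A →ₗ[R] B} {g : B →ₗ[R] C} (h : Function.Exact f g)
    (N : Submodule R B) :
    Function.Exact (f.restrict (p := N.comap f) (q := N) fun _ hx ↦ hx) (g.submoduleMap N) := by
  intro y
  constructor
  · intro hy
    obtain ⟨a, ha⟩ := (h y).1 (by simpa using congrArg Subtype.val hy)
    exact ⟨⟨a, by simp [ha]⟩, Subtype.ext ha⟩
  · rintro ⟨a, rfl⟩
    exact Subtype.ext (h.apply_apply_eq_zero a)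

theorem IsSmall.of_exact_of {α : Ordinal.{u}} {A B C : Type} [AddCommGroup A] [Module R A]
    [AddCommGroup B] [Module R B] [AddCommGroup C] [Module R C] (f : A →ₗ[R] B) (g : B →ₗ[R] C)
    (h : Function.Exact f g)
    (H : ∀ β < α, KdimLE R β A → KdimLE R β C → KdimLE R β B)
    (hA : IsSmall R α A) (hC : IsSmall R α C) : IsSmall R α B := by
  rcases hA with hA | ⟨β, hβ, hA⟩ <;> rcases hC with hC | ⟨γ, hγ, hC⟩
  · refine Or.inl (subsingleton_of_forall_eq 0 fun b ↦ ?_)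
    obtain ⟨a, rfl⟩ := (h b).1 (Subsingleton.elim _ _)
    rw [Subsingleton.elim a 0, map_zero]
  · exact Or.inr ⟨γ, hγ, H γ hγ (kdimLE_of_subsingleton _ _) hC⟩
  · exact Or.inr ⟨β, hβ, H β hβ hA (kdimLE_of_subsingleton _ _)⟩
  · exact Or.inr ⟨max β γ, max_lt hβ hγ, H _ (max_lt hβ hγ)
      (hA.mono (le_max_left _ _)) (hC.mono (le_max_right _ _))⟩

theorem KdimLE.of_exact {α : Ordinal.{u}} : ∀ {A B C : Type} [AddCommGroup A] [Module R A]
    [AddCommGroup B] [Module R B] [AddCommGroup C] [Module R C] (f : A →ₗ[R] B) (g : B →ₗ[R] C),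
    Function.Exact f g → KdimLE R α A → KdimLE R α C → KdimLE R α B := by
  induction α using WellFoundedLT.induction with
  | ind α ih =>
    intro A B C _ _ _ _ _ _ f g h hA hC
    rw [kdimLE_iff] at hA hC ⊢
    intro F hF
    refine ((hA (fun i ↦ (F i).comap f) fun i j hij ↦ Submodule.comap_mono (hF hij)).union
      (hC (fun i ↦ (F i).map g) fun i j hij ↦ Submodule.map_mono (hF hij))).subset fun i hi ↦ ?_
    by_contra hcon
    rw [Set.mem_union, not_or, Set.mem_ofPred_eq, Set.mem_ofPred_eq, not_not, not_not] at hcon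
    refine hi (.of_exact_of _ _
      (exact_mapQ (exact_restrict h (F i)) ((F (i + 1)).comap (F i).subtype))
      (fun β hβ ↦ ih β hβ _ _ (exact_mapQ (exact_restrict h (F i)) _)) hcon.1 ?_)
    convert hcon.2 using 3
    all_goals
      ext ⟨c, hc⟩
      constructor
      · rintro ⟨b, hb, hbc⟩
        exact ⟨b, hb, congrArg Subtype.val hbc⟩
      · rintro ⟨b, hb, hbc⟩
        exact ⟨⟨b, hF (Nat.le_succ i) hb⟩, hb, Subtype.ext hbc⟩

theorem IsSmall.of_exact {α : Ordinal.{u}} {A B C : Type} [AddCommGroup A] [Module R A]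
    [AddCommGroup B] [Module R B] [AddCommGroup C] [Module R C] (f : A →ₗ[R] B) (g : B →ₗ[R] C)
    (h : Function.Exact f g) (hA : IsSmall R α A) (hC : IsSmall R α C) : IsSmall R α B :=
  .of_exact_of f g h (fun _ _ ↦ .of_exact f g h) hA hC

theorem exact_zero_of_injective {A B : Type} [AddCommGroup A] [Module R A] [AddCommGroup B]
    [Module R B] {f : A →ₗ[R] B} (hf : Function.Injective f) :
    Function.Exact (0 : PUnit.{1} →ₗ[R] A) f := by
  rw [LinearMap.exact_iff, LinearMap.ker_eq_bot.2 hf, LinearMap.range_zero]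

theorem exact_zero_of_surjective {A B : Type} [AddCommGroup A] [Module R A] [AddCommGroup B]
    [Module R B] {f : A →ₗ[R] B} (hf : Function.Surjective f) :
    Function.Exact f (0 : B →ₗ[R] PUnit.{1}) := by
  rw [LinearMap.exact_iff, LinearMap.range_eq_top.2 hf, LinearMap.ker_zero]

section

variable {α : Ordinal.{u}} {A B : Type} [AddCommGroup A] [Module R A] [AddCommGroup B] [Module R B]

theorem KdimLE.of_injective (f : A →ₗ[R] B) (hf : Function.Injective f) (hB : KdimLE R α B) :
    KdimLE R α A :=
  .of_exact _ f (exact_zero_of_injective hf) (kdimLE_of_subsingleton _ _) hB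

theorem KdimLE.of_surjective (f : A →ₗ[R] B) (hf : Function.Surjective f) (hA : KdimLE R α A) :
    KdimLE R α B :=
  .of_exact f _ (exact_zero_of_surjective hf) hA (kdimLE_of_subsingleton _ _)

theorem IsSmall.of_injective (f : A →ₗ[R] B) (hf : Function.Injective f) (hB : IsSmall R α B) :
    IsSmall R α A :=
  .of_exact _ f (exact_zero_of_injective hf) (Or.inl inferInstance) hB

theorem IsSmall.of_surjective (f : A →ₗ[R] B) (hf : Function.Surjective f) (hA : IsSmall R α A) :
    IsSmall R α B :=
  .of_exact f _ (exact_zero_of_surjective hf) hA (Or.inl inferInstance)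

theorem KdimLE.pi (hA : KdimLE R α A) (n : ℕ) : KdimLE R α (Fin n → A) := by
  induction n with
  | zero => exact kdimLE_of_subsingleton _ _
  | succ n ih =>
    refine .of_surjective (Fin.consLinearEquiv R fun _ : Fin (n + 1) ↦ A).toLinearMap
      (LinearEquiv.surjective _) ?_
    exact .of_exact (LinearMap.inl R A (Fin n → A)) (LinearMap.snd R A (Fin n → A))
      Function.Exact.inl_snd hA ih

theorem IsSmall.pi (hA : IsSmall R α A) (n : ℕ) : IsSmall R α (Fin n → A) := by
  rcases hA with hA | ⟨β, hβ, hA⟩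
  · exact Or.inl inferInstance
  · exact Or.inr ⟨β, hβ, hA.pi n⟩

end

/-- Every Noetherian module has a Krull dimension. -/
theorem exists_kdimLE (M : Type) [AddCommGroup M] [Module R M] [IsNoetherian R M] :
    ∃ α : Ordinal.{u}, KdimLE R α M := by
  suffices H : ∀ N : Submodule R M, ∃ α : Ordinal.{u}, KdimLE R α (M ⧸ N) by
    obtain ⟨α, hα⟩ := H ⊥
    exact ⟨α, hα.of_injective (Submodule.quotEquivOfEqBot ⊥ rfl).symm.toLinearMap
      (LinearEquiv.injective _)⟩
  intro N
  induction N using IsNoetherian.induction with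
  | _ N ih =>
    choose! a ha using ih
    obtain ⟨γ, hγ⟩ := Ordinal.bddAbove_of_small (s := Set.range a)
    refine ⟨Order.succ γ, kdimLE_iff.2 fun f hf ↦ ?_⟩
    have key : ∀ i, f (i + 1) ≠ ⊥ → IsSmall R (Order.succ γ) (Subquotient (f i) (f (i + 1))) := by
      intro i hi
      have hlt : N < (f (i + 1)).comap N.mkQ := by
        refine lt_of_le_of_ne (N.le_comap_mkQ _) fun h ↦ hi ?_
        rw [← Submodule.map_comap_eq_of_surjective N.mkQ_surjective (f (i + 1)), ← h,
          Submodule.mkQ_map_self]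
      have h1 := (ha _ hlt).mono (hγ ⟨_, rfl⟩)
      refine Or.inr ⟨γ, Order.lt_succ γ, ?_⟩
      have h2 : KdimLE R γ ((M ⧸ N) ⧸ f (i + 1)) := by
        refine h1.of_surjective (Submodule.mapQ _ (f (i + 1)) N.mkQ le_rfl) ?_
        intro y
        obtain ⟨y, rfl⟩ := Submodule.mkQ_surjective _ y
        obtain ⟨y, rfl⟩ := Submodule.mkQ_surjective _ y
        exact ⟨Submodule.Quotient.mk y, rfl⟩
      refine h2.of_injective (Submodule.mapQ _ (f (i + 1)) (f i).subtype le_rfl) ?_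
      rw [← LinearMap.ker_eq_bot, Submodule.mapQ, Submodule.ker_liftQ_eq_bot]
      rw [LinearMap.ker_comp, Submodule.ker_mkQ]
    by_cases h : ∃ n, f n = ⊥
    · obtain ⟨n, hn⟩ := h
      refine (Set.finite_lt_nat n).subset fun i hi ↦ ?_
      by_contra hni
      have : Subsingleton (f i) := by
        rw [le_bot_iff.1 (hn ▸ hf (not_lt.1 hni) : f i ≤ ⊥)]
        infer_instance
      exact hi (Or.inl inferInstance)
    · push Not at h
      refine Set.finite_empty.subset fun i hi ↦ hi (key i (h _))

theorem exists_hasKdim (M : Type) [AddCommGroup M] [Module R M] [IsNoetherian R M] :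
    ∃ α : Ordinal.{u}, HasKdim R α M := by
  obtain ⟨α, hα, hmin⟩ := wellFounded_lt.has_min {α : Ordinal.{u} | KdimLE R α M}
    (exists_kdimLE M)
  exact ⟨α, hα, fun β hβ h ↦ hmin β h hβ⟩

theorem HasKdim.not_isSmall {α : Ordinal.{u}} {M : Type} [AddCommGroup M] [Module R M]
    [Nontrivial M] (h : HasKdim R α M) : ¬ IsSmall R α M := by
  rintro (h' | ⟨β, hβ, h'⟩)
  · exact not_subsingleton M h'
  · exact h.2 β hβ h'

theorem KdimLE.of_finite {α : Ordinal.{u}} (hR : KdimLE R α R) (M : Type) [AddCommGroup M]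
    [Module R M] [Module.Finite R M] : KdimLE R α M := by
  obtain ⟨n, f, hf⟩ := Module.Finite.exists_fin' R M
  exact (hR.pi n).of_surjective f hf

/-- Every proper submodule `N` of a module of Krull dimension at most `α` is contained in a
larger submodule `K` such that the proper quotients of `K / N` have Krull dimension
less than `α`. -/
theorem KdimLE.exists_gt_isSmall {α : Ordinal.{u}} {M : Type} [AddCommGroup M] [Module R M]
    (h : KdimLE R α M) {N : Submodule R M} (hN : N < ⊤) :
    ∃ K > N, ∀ L > N, L ≤ K → IsSmall R α (Subquotient K L) := by
  by_contra! hcon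
  choose! s hs using hcon
  let F : ℕ → Submodule R M := fun n ↦ s^[n] ⊤
  have hF' : ∀ n, F (n + 1) = s (F n) := fun n ↦ Function.iterate_succ_apply' s n ⊤
  have hF : ∀ n, N < F n := by
    intro n
    induction n with
    | zero => exact hN
    | succ n ih =>
      rw [hF']
      exact (hs _ ih).1
  refine Set.infinite_univ ((kdimLE_iff.1 h F (antitone_nat_of_succ_le fun n ↦ ?_)).subset
    fun n _ ↦ ?_)
  · rw [hF']
    exact (hs _ (hF n)).2.1
  · rw [Set.mem_ofPred_eq, hF']
    exact (hs _ (hF n)).2.2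

/-- All proper quotients of `S` are zero or have Krull dimension strictly less than `α`. -/
def IsAlmostCritical (R : Type) [Ring R] (α : Ordinal.{u}) (S : Type) [AddCommGroup S]
    [Module R S] : Prop :=
  ∀ T : Submodule R S, T ≠ ⊥ → IsSmall R α (S ⧸ T)

theorem isAlmostCritical_subquotient {α : Ordinal.{u}} {M : Type} [AddCommGroup M] [Module R M]
    {N K : Submodule R M} (hNK : N ≤ K)
    (h : ∀ L > N, L ≤ K → IsSmall R α (Subquotient K L)) :
    IsAlmostCritical R α (Subquotient K N) := by
  intro T hT
  let L : Submodule R M := (T.comap (Submodule.mkQ _)).map K.subtype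
  have hL : L.comap K.subtype = T.comap (Submodule.mkQ _) :=
    Submodule.comap_map_eq_of_injective K.injective_subtype _
  have hNL : N < L := by
    refine lt_of_le_of_ne (fun n hn ↦ ⟨⟨n, hNK hn⟩, ?_, rfl⟩) fun hNL ↦ hT ?_
    · have h0 : (Submodule.Quotient.mk ⟨n, hNK hn⟩ : Subquotient K N) = 0 :=
        (Submodule.Quotient.mk_eq_zero _).2 hn
      rw [SetLike.mem_coe, Submodule.mem_comap, Submodule.mkQ_apply, h0]
      exact T.zero_mem
    · rw [← Submodule.map_comap_eq_of_surjective (Submodule.mkQ_surjective _) T, ← hL, ← hNL,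
        Submodule.mkQ_map_self]
  refine (h L hNL (Submodule.map_subtype_le _ _)).of_surjective
    (Submodule.liftQ _ (T.mkQ ∘ₗ Submodule.mkQ _) ?_) ?_
  · rw [LinearMap.ker_comp, Submodule.ker_mkQ, hL]
  · rw [← LinearMap.range_eq_top, Submodule.range_liftQ, LinearMap.range_eq_top]
    exact T.mkQ_surjective.comp (Submodule.mkQ_surjective _)

theorem exact_subquotient {M : Type} [AddCommGroup M] [Module R M] {K P Q : Submodule R M}
    (hQ : K ⊔ P = Q) :
    Function.Exact (Submodule.mapQ (P.comap K.subtype) P K.subtype le_rfl)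
      (Submodule.factor (le_sup_right.trans hQ.le : P ≤ Q)) := by
  intro y
  obtain ⟨y, rfl⟩ := P.mkQ_surjective y
  rw [Submodule.factor_mk, Submodule.mkQ_apply, Submodule.mkQ_apply, Submodule.Quotient.mk_eq_zero, ← hQ,
    Submodule.mem_sup]
  constructor
  · rintro ⟨k, hk, p, hp, rfl⟩
    refine ⟨Submodule.Quotient.mk ⟨k, hk⟩, ?_⟩
    rw [Submodule.mapQ_apply, Submodule.Quotient.eq]
    simpa using hp
  · rintro ⟨a, ha⟩
    obtain ⟨a, rfl⟩ := Submodule.mkQ_surjective _ a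
    rw [Submodule.mkQ_apply, Submodule.mapQ_apply, Submodule.Quotient.eq] at ha
    exact ⟨a, a.2, y - a, by simpa using P.neg_mem ha, by simp⟩

end KrullDimension

section Length

universe u

variable {R : Type} [Ring R]

/-- `LengthGE α k M` means that `M` has a descending chain of submodules with `k` successive
factors that are nonzero and not of Krull dimension less than `α`. -/
def LengthGE {R : Type} [Ring R] (α : Ordinal.{u}) :
    ℕ → (M : Type) → [AddCommGroup M] → [Module R M] → Prop
  | 0, _, _, _ => True
  | k + 1, M, _, _ => ∃ N : Submodule R M, ¬ IsSmall R α (M ⧸ N) ∧ LengthGE (R := R) α k N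

/-- `HasLength R α M k` means that `M` has length `k` modulo the modules of Krull dimension
less than `α`. -/
def HasLength (R : Type) [Ring R] (α : Ordinal.{u}) (M : Type) [AddCommGroup M] [Module R M]
    (k : ℕ) : Prop :=
  LengthGE (R := R) α k M ∧ ¬ LengthGE (R := R) α (k + 1) M

variable {α : Ordinal.{u}}

theorem LengthGE.of_injective {k : ℕ} : ∀ {A B : Type} [AddCommGroup A] [Module R A]
    [AddCommGroup B] [Module R B] (f : A →ₗ[R] B), Function.Injective f →
    LengthGE (R := R) α k A → LengthGE (R := R) α k B := by
  induction k with
  | zero => exact fun _ _ _ ↦ trivial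
  | succ k ih =>
    rintro A B _ _ _ _ f hf ⟨N, hN, hk⟩
    refine ⟨N.map f, fun h ↦ hN ?_, ih (f.submoduleMap N) (fun x y hxy ↦ ?_) hk⟩
    · refine h.of_injective (Submodule.mapQ _ _ f (Submodule.le_comap_map f N)) ?_
      rw [← LinearMap.ker_eq_bot, Submodule.mapQ, Submodule.ker_liftQ_eq_bot]
      rw [LinearMap.ker_comp, Submodule.ker_mkQ, Submodule.comap_map_eq_of_injective hf]
    · exact Subtype.ext (hf (congrArg Subtype.val hxy))

theorem LengthGE.mono {j k : ℕ} (hjk : j ≤ k) {M : Type} [AddCommGroup M] [Module R M]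
    (h : LengthGE (R := R) α k M) : LengthGE (R := R) α j M := by
  induction k, hjk using Nat.le_induction with
  | base => exact h
  | succ k _ ih =>
    obtain ⟨N, -, hN⟩ := h
    exact ih (hN.of_injective N.subtype N.injective_subtype)

theorem LengthGE.split {k : ℕ} : ∀ {A B C : Type} [AddCommGroup A] [Module R A]
    [AddCommGroup B] [Module R B] [AddCommGroup C] [Module R C] (f : A →ₗ[R] B) (g : B →ₗ[R] C),
    Function.Exact f g → LengthGE (R := R) α k B →
    ∃ a b, a + b = k ∧ LengthGE (R := R) α a A ∧ LengthGE (R := R) α b C := by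
  induction k with
  | zero => exact fun _ _ _ _ ↦ ⟨0, 0, rfl, trivial, trivial⟩
  | succ k ih =>
    rintro A B C _ _ _ _ _ _ f g h ⟨N, hN, hk⟩
    obtain ⟨a, b, rfl, ha, hb⟩ := ih _ _ (exact_restrict h N) hk
    by_cases hA : IsSmall R α (A ⧸ N.comap f)
    · exact ⟨a, b + 1, rfl, ha.of_injective _ (Submodule.injective_subtype _),
        N.map g, fun hC ↦ hN (.of_exact _ _ (exact_mapQ h N) hA hC), hb⟩
    · exact ⟨a + 1, b, by ring, ⟨N.comap f, hA, ha⟩,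
        hb.of_injective _ (Submodule.injective_subtype _)⟩

theorem LengthGE.add {a b : ℕ} : ∀ {A B C : Type} [AddCommGroup A] [Module R A]
    [AddCommGroup B] [Module R B] [AddCommGroup C] [Module R C] (f : A →ₗ[R] B) (g : B →ₗ[R] C),
    Function.Exact f g → Function.Injective f → Function.Surjective g →
    LengthGE (R := R) α a A → LengthGE (R := R) α b C → LengthGE (R := R) α (a + b) B := by
  induction b with
  | zero => exact fun f _ _ hf _ ha _ ↦ ha.of_injective f hf
  | succ b ih =>
    rintro A B C _ _ _ _ _ _ f g h hf hg ha ⟨N, hN, hb⟩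
    refine ⟨N.comap g, fun hs ↦ hN (hs.of_surjective (Submodule.mapQ _ N g le_rfl) ?_), ?_⟩
    · intro y
      obtain ⟨y, rfl⟩ := Submodule.mkQ_surjective _ y
      obtain ⟨y, rfl⟩ := hg y
      exact ⟨Submodule.Quotient.mk y, rfl⟩
    · refine ih (f.codRestrict (N.comap g) fun x ↦ ?_)
        (g.restrict (p := N.comap g) (q := N) fun _ hx ↦ hx) ?_ ?_ ?_ ha hb
      · rw [Submodule.mem_comap, h.apply_apply_eq_zero]
        exact N.zero_mem
      · intro y
        rw [← Subtype.coe_inj]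
        refine (h y).trans ⟨?_, ?_⟩
        · rintro ⟨x, hx⟩
          exact ⟨x, Subtype.ext hx⟩
        · rintro ⟨x, hx⟩
          exact ⟨x, congrArg Subtype.val hx⟩
      · exact fun x y hxy ↦ hf (congrArg Subtype.val hxy)
      · rintro ⟨y, hy⟩
        obtain ⟨x, rfl⟩ := hg y
        exact ⟨⟨x, hy⟩, rfl⟩

theorem HasLength.unique {M : Type} [AddCommGroup M] [Module R M] {j k : ℕ}
    (hj : HasLength R α M j) (hk : HasLength R α M k) : j = k := by
  by_contra hne
  rcases lt_or_gt_of_ne hne with h | h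
  · exact hj.2 (hk.1.mono h)
  · exact hk.2 (hj.1.mono h)

theorem HasLength.of_exact {a b : ℕ} {A B C : Type} [AddCommGroup A] [Module R A]
    [AddCommGroup B] [Module R B] [AddCommGroup C] [Module R C] (f : A →ₗ[R] B) (g : B →ₗ[R] C)
    (h : Function.Exact f g) (hf : Function.Injective f) (hg : Function.Surjective g)
    (ha : HasLength R α A a) (hb : HasLength R α C b) : HasLength R α B (a + b) := by
  refine ⟨ha.1.add f g h hf hg hb.1, fun hB ↦ ?_⟩
  obtain ⟨a', b', hab, ha', hb'⟩ := hB.split f g h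
  have h1 : a' ≤ a := not_lt.1 fun hlt ↦ ha.2 (ha'.mono hlt)
  have h2 : b' ≤ b := not_lt.1 fun hlt ↦ hb.2 (hb'.mono hlt)
  omega

theorem IsSmall.hasLength_zero {M : Type} [AddCommGroup M] [Module R M] (h : IsSmall R α M) :
    HasLength R α M 0 :=
  ⟨trivial, fun ⟨N, hN, _⟩ ↦ hN (h.of_surjective N.mkQ N.mkQ_surjective)⟩

theorem HasLength.isSmall {M : Type} [AddCommGroup M] [Module R M] (h : HasLength R α M 0) :
    IsSmall R α M := by
  by_contra hM
  exact h.2 ⟨⊥, fun h' ↦ hM (h'.of_surjective (Submodule.quotEquivOfEqBot ⊥ rfl).toLinearMap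
    (LinearEquiv.surjective _)), trivial⟩

theorem IsAlmostCritical.hasLength_one {S : Type} [AddCommGroup S] [Module R S]
    (h : IsAlmostCritical R α S) (hS : ¬ IsSmall R α S) : HasLength R α S 1 := by
  refine ⟨by_contra fun h1 ↦ hS (HasLength.isSmall ⟨trivial, h1⟩), ?_⟩
  rintro ⟨N, hN, K, hK, -⟩
  obtain rfl : N = ⊥ := by_contra fun h' ↦ hN (h N h')
  exact hK (Or.inl inferInstance)

theorem HasLength.pi {M : Type} [AddCommGroup M] [Module R M] {k : ℕ} (h : HasLength R α M k)
    (n : ℕ) : HasLength R α (Fin n → M) (n * k) := by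
  induction n with
  | zero => simpa using IsSmall.hasLength_zero (Or.inl inferInstance)
  | succ n ih =>
    have h' := HasLength.of_exact
      ((Fin.consLinearEquiv R fun _ : Fin (n + 1) ↦ M).toLinearMap ∘ₗ LinearMap.inl R M _)
      (LinearMap.snd R M (Fin n → M) ∘ₗ (Fin.consLinearEquiv R fun _ ↦ M).symm.toLinearMap)
      ?_ ?_ ?_ h ih
    · rwa [Nat.succ_mul, add_comm (n * k)]
    · intro y
      obtain ⟨y, rfl⟩ := (Fin.consLinearEquiv R fun _ : Fin (n + 1) ↦ M).surjective y
      simpa using Function.Exact.inl_snd (R := R) (M := M) (N := Fin n → M) y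
    · exact (Fin.consLinearEquiv R fun _ : Fin (n + 1) ↦ M).injective.comp LinearMap.inl_injective
    · exact (LinearMap.snd_surjective (R := R) (M := M) (M₂ := Fin n → M)).comp
        (LinearEquiv.surjective _)

end Length

section SimpleRing

variable {R : Type} [Ring R] [IsSimpleRing R]

/-- A nonzero module over a simple ring is faithful. -/
theorem exists_smul_ne_zero (N : Type) [AddCommGroup N] [Module R N] [Nontrivial N] {r : R}
    (hr : r ≠ 0) : ∃ n : N, r • n ≠ 0 := by
  by_contra! h
  obtain ⟨x, hx⟩ := exists_ne (0 : N)
  have : Nontrivial (AddMonoid.End N) := ⟨1, 0, fun h ↦ hx (DFunLike.congr_fun h x)⟩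
  refine hr ((Module.toAddMonoidEnd R N).injective ?_)
  rw [map_zero]
  ext n
  exact h n

/-- A nonzero left ideal of a simple ring generates the ring as a left module. -/
theorem exists_pi_surjective {K : Submodule R R} (hK : K ≠ ⊥) :
    ∃ (n : ℕ) (p : (Fin n → K) →ₗ[R] R), Function.Surjective p := by
  let F : (R →₀ K) →ₗ[R] R :=
    Finsupp.lsum ℕ fun r ↦ LinearMap.toSpanSingleton R R r ∘ₗ K.subtype
  have hF : LinearMap.range F = ⊤ := by
    by_contra hne
    have : Nontrivial (R ⧸ LinearMap.range F) := Submodule.Quotient.nontrivial_iff.2 hne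
    obtain ⟨x, hx, hx0⟩ := Submodule.exists_mem_ne_zero_of_ne_bot hK
    obtain ⟨q, hq⟩ := exists_smul_ne_zero (R ⧸ LinearMap.range F) hx0
    obtain ⟨r, rfl⟩ := Submodule.mkQ_surjective _ q
    refine hq ((Submodule.Quotient.mk_eq_zero _).2 ⟨Finsupp.single r ⟨x, hx⟩, ?_⟩)
    simp [F]
  obtain ⟨v, hv⟩ := LinearMap.range_eq_top.1 hF 1
  let e := v.support.equivFin
  let p : (Fin v.support.card → K) →ₗ[R] R :=
    ∑ i, (LinearMap.toSpanSingleton R R (e.symm i : R) ∘ₗ K.subtype) ∘ₗ LinearMap.proj i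
  have hp : p (fun i ↦ v (e.symm i)) = 1 := by
    rw [← hv]
    simp only [p, F, LinearMap.sum_apply, Finsupp.lsum_apply, Finsupp.sum, LinearMap.comp_apply,
      LinearMap.proj_apply]
    rw [← Finset.sum_coe_sort v.support]
    exact Equiv.sum_comp e.symm
      (fun r : v.support ↦ (LinearMap.toSpanSingleton R R (r : R)) (K.subtype (v r)))
  exact ⟨_, p, fun r ↦ ⟨r • fun i ↦ v (e.symm i), by rw [map_smul, hp, smul_eq_mul, mul_one]⟩⟩

universe u

variable {α : Ordinal.{u}}

/-- Over a simple left Noetherian ring whose Krull dimension is not at most `α`, every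
finitely generated module of Krull dimension at most `α` is cyclic modulo modules of
smaller Krull dimension. -/
theorem KdimLE.exists_isSmall_quotient_span (hR : ¬ KdimLE R α R) {M : Type} [AddCommGroup M]
    [Module R M] [IsNoetherian R M] (hM : KdimLE R α M) :
    ∃ m : M, IsSmall R α (M ⧸ (R ∙ m)) := by
  suffices H : ∀ N : Submodule R M, ∃ m : M, IsSmall R α (M ⧸ (N ⊔ (R ∙ m))) by
    obtain ⟨m, hm⟩ := H ⊥
    exact ⟨m, by rwa [bot_sup_eq] at hm⟩
  intro N
  induction N using IsNoetherian.induction with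
  | _ N ih =>
    rcases eq_or_ne N ⊤ with rfl | hN
    · refine ⟨0, Or.inl ?_⟩
      rw [top_sup_eq]
      infer_instance
    obtain ⟨K, hNK, hK⟩ := hM.exists_gt_isSmall (lt_top_iff_ne_top.2 hN)
    obtain ⟨m, hm⟩ := ih K hNK
    by_cases hcase : ∃ k ∈ K, ¬ K ⊓ (N ⊔ (R ∙ (m + k))) ≤ N
    · obtain ⟨k, hk, hkN⟩ := hcase
      refine ⟨m + k, .of_exact _ _ (exact_subquotient (K := K) (P := N ⊔ (R ∙ (m + k)))
        (Q := K ⊔ (R ∙ m)) ?_) ?_ hm⟩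
      · rw [← sup_assoc, sup_eq_left.2 hNK.le]
        refine le_antisymm (sup_le le_sup_left ?_) (sup_le le_sup_left ?_)
        · rw [Submodule.span_singleton_le_iff_mem]
          exact add_mem (Submodule.mem_sup_right (Submodule.mem_span_singleton_self m))
            (Submodule.mem_sup_left hk)
        · rw [Submodule.span_singleton_le_iff_mem]
          have := sub_mem (Submodule.mem_sup_right (Submodule.mem_span_singleton_self (m + k)))
            (Submodule.mem_sup_left hk : k ∈ K ⊔ (R ∙ (m + k)))
          rwa [add_sub_cancel_right] at this
      · have := hK (K ⊓ (N ⊔ (R ∙ (m + k))))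
          (lt_of_le_not_ge (le_inf hNK.le le_sup_left) hkN) inf_le_left
        refine this.of_surjective (Submodule.quotEquivOfEq _ _ ?_).toLinearMap
          (LinearEquiv.surjective _)
        rw [Submodule.comap_inf, Submodule.comap_subtype_self, top_inf_eq]
    · push Not at hcase
      refine absurd (hM.of_surjective N.mkQ N.mkQ_surjective) fun hMN ↦ hR ?_
      refine hMN.of_injective (LinearMap.toSpanSingleton R (M ⧸ N) (N.mkQ m)) ?_
      rw [injective_iff_map_eq_zero]
      intro r hr
      rw [LinearMap.toSpanSingleton_apply, ← map_smul, Submodule.mkQ_apply,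
        Submodule.Quotient.mk_eq_zero] at hr
      by_contra hr0
      have : Nontrivial (Subquotient K N) := by
        rw [Submodule.Quotient.nontrivial_iff]
        intro h
        exact hNK.not_ge (Submodule.comap_subtype_eq_top.1 h)
      obtain ⟨q, hq⟩ := exists_smul_ne_zero (Subquotient K N) hr0
      obtain ⟨k, rfl⟩ := Submodule.mkQ_surjective _ q
      refine hq ((Submodule.Quotient.mk_eq_zero _).2 (hcase k k.2 ⟨K.smul_mem r k.2, ?_⟩))
      have h1 : r • (m + (k : M)) - r • m ∈ N ⊔ (R ∙ (m + (k : M))) :=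
        sub_mem (Submodule.mem_sup_right (Submodule.smul_mem _ r
          (Submodule.mem_span_singleton_self _))) (Submodule.mem_sup_left hr)
      rw [smul_add, add_sub_cancel_left] at h1
      exact h1

end SimpleRing

namespace SylvesterModuleRank

universe u

variable {R : Type} [Ring R] [IsNoetherianRing R] (dim : SylvesterModuleRank R)

theorem d_eq_zero_of_subsingleton (M : Type) [AddCommGroup M] [Module R M] [Subsingleton M] :
    dim.d M = 0 := by
  rw [← dim.d_bot]
  exact dim.d_congr M PUnit (Module.finitePresentation_of_finite R M) 0

theorem nonneg (M : Type) [AddCommGroup M] [Module R M] [Module.Finite R M] : 0 ≤ dim.d M :=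
  dim.d_nonneg M (Module.finitePresentation_of_finite R M)

theorem d_le_of_surjective {A B : Type} [AddCommGroup A] [Module R A] [Module.Finite R A]
    [AddCommGroup B] [Module R B] (f : A →ₗ[R] B) (hf : Function.Surjective f) :
    dim.d B ≤ dim.d A := by
  have : Module.Finite R B := .of_surjective f hf
  exact (dim.d_exact (LinearMap.ker f) A B (Module.finitePresentation_of_finite R _)
    (Module.finitePresentation_of_finite R _) (Module.finitePresentation_of_finite R _)
    (LinearMap.ker f).subtype f (LinearMap.exact_subtype_ker_map f) hf).1

theorem d_le_add {A B C : Type} [AddCommGroup A] [Module R A] [Module.Finite R A]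
    [AddCommGroup B] [Module R B] [Module.Finite R B] [AddCommGroup C] [Module R C]
    (f : A →ₗ[R] B) (g : B →ₗ[R] C) (h : Function.Exact f g) (hg : Function.Surjective g) :
    dim.d B ≤ dim.d A + dim.d C := by
  have : Module.Finite R C := .of_surjective g hg
  exact (dim.d_exact A B C (Module.finitePresentation_of_finite R _)
    (Module.finitePresentation_of_finite R _) (Module.finitePresentation_of_finite R _)
    f g h hg).2

theorem d_pi (M : Type) [AddCommGroup M] [Module R M] [Module.Finite R M] (n : ℕ) :
    dim.d (Fin n → M) = n * dim.d M := by
  induction n with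
  | zero => simpa using dim.d_eq_zero_of_subsingleton (Fin 0 → M)
  | succ n ih =>
    rw [← dim.d_congr (M × (Fin n → M)) (Fin (n + 1) → M)
      (Module.finitePresentation_of_finite R _) (Fin.consLinearEquiv R fun _ ↦ M),
      dim.d_add _ _ (Module.finitePresentation_of_finite R _)
      (Module.finitePresentation_of_finite R _), ih]
    push_cast
    ring

theorem d_eq_add_of_surjective {A : Type} [AddCommGroup A] [Module R A] [Module.Finite R A]
    (p : A →ₗ[R] R) (hp : Function.Surjective p) :
    dim.d A = dim.d (LinearMap.ker p) + 1 := by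
  obtain ⟨l, hl⟩ := Module.projective_lifting_property p LinearMap.id hp
  let e := ((LinearMap.exact_subtype_ker_map p).splitSurjectiveEquiv
    (LinearMap.ker p).injective_subtype ⟨l, hl⟩).1
  rw [dim.d_congr _ _ (Module.finitePresentation_of_finite R _) e,
    dim.d_add _ _ (Module.finitePresentation_of_finite R _)
      (Module.finitePresentation_of_finite R _), dim.d_self]

variable [IsSimpleRing R]

theorem d_eq_zero_of_kdimLE {α : Ordinal.{u}} (hR : ¬ KdimLE R α R) : ∀ (M : Type)
    [AddCommGroup M] [Module R M] [Module.Finite R M], KdimLE R α M → dim.d M = 0 := by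
  induction α using WellFoundedLT.induction with
  | ind α ih =>
    intro M _ _ _ hM
    have bound : ∀ n : ℕ, n * dim.d M ≤ 1 := by
      intro n
      obtain ⟨m, hm⟩ := (hM.pi n).exists_isSmall_quotient_span hR
      have h0 : dim.d ((Fin n → M) ⧸ (R ∙ m)) = 0 := by
        rcases hm with hm | ⟨β, hβ, hm⟩
        · exact dim.d_eq_zero_of_subsingleton _
        · exact ih β hβ (fun h ↦ hR (h.mono hβ.le)) _ hm
      have h1 : dim.d (R ∙ m) ≤ 1 := by
        rw [← dim.d_self, ← LinearMap.range_toSpanSingleton]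
        exact dim.d_le_of_surjective _
          (LinearMap.toSpanSingleton R (Fin n → M) m).surjective_rangeRestrict
      have h2 := dim.d_le_add _ _ (LinearMap.exact_subtype_mkQ (R ∙ m))
        (Submodule.mkQ_surjective _)
      rw [d_pi] at h2
      linarith
    by_contra hne
    have hpos : 0 < dim.d M := lt_of_le_of_ne (dim.nonneg M) (Ne.symm hne)
    obtain ⟨n, hn⟩ := exists_nat_gt (1 / dim.d M)
    rw [div_lt_iff₀ hpos] at hn
    exact (bound n).not_gt hn

theorem d_eq_zero_of_isSmall {β : Ordinal.{u}} (hβ : HasKdim R β R) (M : Type) [AddCommGroup M]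
    [Module R M] [Module.Finite R M] (hM : IsSmall R β M) : dim.d M = 0 := by
  rcases hM with hM | ⟨γ, hγ, hM⟩
  · exact dim.d_eq_zero_of_subsingleton M
  · exact dim.d_eq_zero_of_kdimLE (hβ.2 γ hγ) M hM

theorem d_quotient_span_singleton_eq_zero {x : R} (hx : ∀ z : R, z * x = 0 → z = 0) :
    dim.d (R ⧸ (R ∙ x)) = 0 := by
  obtain ⟨β, hβ⟩ := exists_hasKdim.{0} (R := R) R
  obtain ⟨i, hi⟩ := ((kdimLE_iff.1 hβ.1 (fun i ↦ R ∙ x ^ i) (antitone_nat_of_succ_le fun i ↦ by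
    rw [Submodule.span_singleton_le_iff_mem, pow_succ']
    exact Submodule.smul_mem _ x (Submodule.mem_span_singleton_self _)))).exists_notMem
  rw [Set.mem_ofPred_eq, not_not] at hi
  have hxi : ∀ z : R, z * x ^ i = 0 → z = 0 := by
    clear hi
    induction i with
    | zero => simp
    | succ i ih => exact fun z hz ↦ ih z (hx _ (by rwa [mul_assoc, ← pow_succ]))
  refine dim.d_eq_zero_of_isSmall hβ _ (hi.of_injective (Submodule.mapQ _ _
    ((LinearMap.toSpanSingleton R R (x ^ i)).codRestrict (R ∙ x ^ i) fun r ↦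
      Submodule.smul_mem _ r (Submodule.mem_span_singleton_self _)) ?_) ?_)
  · rw [Submodule.span_singleton_le_iff_mem]
    exact Submodule.mem_span_singleton.2 ⟨1, (one_smul R _).trans (pow_succ' x i)⟩
  · rw [← LinearMap.ker_eq_bot, Submodule.mapQ, Submodule.ker_liftQ_eq_bot]
    intro r hr
    rw [LinearMap.ker_comp, Submodule.ker_mkQ] at hr
    obtain ⟨s, hs⟩ := Submodule.mem_span_singleton.1 (show r * x ^ i ∈ R ∙ x ^ (i + 1) from hr)
    refine Submodule.mem_span_singleton.2 ⟨s, sub_eq_zero.1 (hxi _ ?_)⟩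
    rw [sub_mul, sub_eq_zero, ← hs, smul_eq_mul, smul_eq_mul, mul_assoc, pow_succ']

/-- The rank of an almost critical module is bounded by that of any nonzero left ideal. -/
theorem d_le_of_isAlmostCritical {β : Ordinal.{u}} (hβ : HasKdim R β R) {K : Submodule R R}
    (hK : K ≠ ⊥) (S : Type) [AddCommGroup S] [Module R S] [Module.Finite R S]
    (hS : IsAlmostCritical R β S) : dim.d S ≤ dim.d K := by
  rcases subsingleton_or_nontrivial S with h | h
  · rw [dim.d_eq_zero_of_subsingleton S]
    exact dim.nonneg K
  obtain ⟨x, hx, hx0⟩ := Submodule.exists_mem_ne_zero_of_ne_bot hK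
  obtain ⟨s, hs⟩ := exists_smul_ne_zero S hx0
  let f : K →ₗ[R] S := LinearMap.toSpanSingleton R S s ∘ₗ K.subtype
  have hf : LinearMap.range f ≠ ⊥ := fun h ↦
    hs ((Submodule.mem_bot R).1 (h ▸ ⟨⟨x, hx⟩, rfl⟩))
  have h1 := dim.d_le_add f (LinearMap.range f).mkQ (LinearMap.exact_map_mkQ_range f)
    (Submodule.mkQ_surjective _)
  rwa [dim.d_eq_zero_of_isSmall hβ _ (hS _ hf), add_zero] at h1

theorem exists_hasLength_d_le {β : Ordinal.{u}} (hβ : HasKdim R β R) {K : Submodule R R}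
    (hK : K ≠ ⊥) (M : Type) [AddCommGroup M] [Module R M] [Module.Finite R M] :
    ∃ k, HasLength R β M k ∧ dim.d M ≤ k * dim.d K := by
  have hM := hβ.1.of_finite M
  suffices H : ∀ N : Submodule R M, ∃ k, HasLength R β (M ⧸ N) k ∧ dim.d (M ⧸ N) ≤ k * dim.d K by
    obtain ⟨k, hk, hd⟩ := H ⊥
    let e := Submodule.quotEquivOfEqBot (⊥ : Submodule R M) rfl
    refine ⟨k, ?_, (dim.d_le_of_surjective e.toLinearMap e.surjective).trans hd⟩
    have := HasLength.of_exact (0 : PUnit.{1} →ₗ[R] M) e.symm.toLinearMap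
      (exact_zero_of_injective e.symm.injective) (Function.injective_of_subsingleton _)
      e.symm.surjective (IsSmall.hasLength_zero (Or.inl inferInstance)) hk
    rwa [zero_add] at this
  intro N
  induction N using IsNoetherian.induction with
  | _ N ih =>
    rcases eq_or_ne N ⊤ with rfl | hN
    · refine ⟨0, IsSmall.hasLength_zero (Or.inl inferInstance), ?_⟩
      rw [dim.d_eq_zero_of_subsingleton, Nat.cast_zero, zero_mul]
    obtain ⟨L, hNL, hL⟩ := hM.exists_gt_isSmall (lt_top_iff_ne_top.2 hN)
    obtain ⟨k, hk, hkd⟩ := ih L hNL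
    have hcrit := isAlmostCritical_subquotient hNL.le hL
    obtain ⟨j, hj, hjd⟩ : ∃ j : ℕ, HasLength R β (Subquotient L N) j ∧
        dim.d (Subquotient L N) ≤ j * dim.d K := by
      by_cases hs : IsSmall R β (Subquotient L N)
      · exact ⟨0, hs.hasLength_zero, by simp [dim.d_eq_zero_of_isSmall hβ _ hs]⟩
      · exact ⟨1, hcrit.hasLength_one hs, by
          simpa using dim.d_le_of_isAlmostCritical hβ hK _ hcrit⟩
    have hexact := exact_subquotient (sup_eq_left.2 hNL.le)
    have hsurj := Submodule.factor_surjective hNL.le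
    refine ⟨j + k, hj.of_exact _ _ hexact ?_ hsurj hk,
      (dim.d_le_add _ _ hexact hsurj).trans ?_⟩
    · rw [← LinearMap.ker_eq_bot, Submodule.mapQ, Submodule.ker_liftQ_eq_bot]
      rw [LinearMap.ker_comp, Submodule.ker_mkQ]
    · push_cast
      linarith

/-- The rank of a module is its length modulo modules of Krull dimension less than that of
`R`, divided by the length of `R`. -/
theorem d_mul_length {β : Ordinal.{u}} (hβ : HasKdim R β R) {n : ℕ} (hn : HasLength R β R n)
    {M : Type} [AddCommGroup M] [Module R M] [Module.Finite R M] {k : ℕ}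
    (hk : HasLength R β M k) : dim.d M * n = k := by
  obtain ⟨K, hK, hKcrit⟩ := hβ.1.exists_gt_isSmall (bot_lt_top (α := Submodule R R))
  have hK0 : K ≠ ⊥ := hK.ne'
  have bound : ∀ (M : Type) [AddCommGroup M] [Module R M] [Module.Finite R M] {k : ℕ},
      HasLength R β M k → dim.d M ≤ k * dim.d K := by
    intro M _ _ _ k hk
    obtain ⟨j, hj, hjd⟩ := dim.exists_hasLength_d_le hβ hK0 M
    rwa [hk.unique hj]
  obtain ⟨m, p, hp⟩ := exists_pi_surjective hK0
  have hKsmall : ¬ IsSmall R β K := fun h ↦ hβ.not_isSmall ((h.pi m).of_surjective p hp)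
  have hK1 : HasLength R β K 1 := by
    refine IsAlmostCritical.hasLength_one (fun T hT ↦ ?_) hKsmall
    rw [← Submodule.comap_map_eq_of_injective K.injective_subtype T]
    refine hKcrit _ (bot_lt_iff_ne_bot.2 fun h ↦ hT ?_) (Submodule.map_subtype_le K T)
    exact Submodule.map_injective_of_injective K.injective_subtype
      (h.trans (Submodule.map_bot _).symm)
  have hu : n * dim.d K = 1 := by
    obtain ⟨j, hj, hjd⟩ := dim.exists_hasLength_d_le hβ hK0 (LinearMap.ker p)
    have hlen := (hK1.pi m).unique (hj.of_exact _ p (LinearMap.exact_subtype_ker_map p)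
      (LinearMap.ker p).injective_subtype hp hn)
    have h1 := dim.d_eq_add_of_surjective p hp
    rw [dim.d_pi] at h1
    have h2 := bound R hn
    rw [dim.d_self] at h2
    have h3 : (m : ℝ) = j + n := by exact_mod_cast (mul_one m ▸ hlen)
    rw [h3] at h1
    linarith
  obtain ⟨q, f, hf⟩ := Module.Finite.exists_fin' R M
  obtain ⟨j, hj, hjd⟩ := dim.exists_hasLength_d_le hβ hK0 (LinearMap.ker f)
  have hlen := (hn.pi q).unique (hj.of_exact _ f (LinearMap.exact_subtype_ker_map f)
    (LinearMap.ker f).injective_subtype hf hk)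
  have h1 := dim.d_le_add _ f (LinearMap.exact_subtype_ker_map f) hf
  rw [dim.d_pi, dim.d_self] at h1
  have h2 := bound M hk
  have h3 : (q : ℝ) * n = j + k := by exact_mod_cast hlen
  have h4 : (q : ℝ) * (n * dim.d K) = j * dim.d K + k * dim.d K := by
    rw [← mul_assoc, h3]
    ring
  rw [hu] at h4
  have h5 : dim.d M = k * dim.d K := by linarith
  rw [h5, mul_assoc, mul_comm (dim.d K), hu, mul_one]

end SylvesterModuleRank

/-- Let `R` be a simple left Noetherian ring and `dim` a Sylvester module rank function
on `R`. Then (1) `dim M = 0` for every finitely generated left `R`-module `M` with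
`Kdim M < Kdim R`; (2) the associated matrix rank function satisfies `rk x = 1`, i.e.
`1 - dim (R ⧸ Rx) = 1`, for every non-zero-divisor `x`; (3) `R` has a unique Sylvester
rank function (the one induced from the classical left quotient ring of `R`). -/
theorem simple_noetherian_unique_rank (R : Type) [Ring R] [IsSimpleRing R]
    [IsNoetherianRing R] (dim : SylvesterModuleRank R) :
    (∀ (M : Type) [AddCommGroup M] [Module R M], Module.Finite R M →
      (∃ α β : Ordinal, HasKdim R α M ∧ HasKdim R β R ∧ α < β) → dim.d M = 0) ∧
    (∀ x : R, (∀ z : R, z * x = 0 → z = 0) → (∀ z : R, x * z = 0 → z = 0) →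
      (1 : ℝ) - dim.d (R ⧸ (Submodule.span R {x} : Submodule R R)) = 1) ∧
    (∀ dim' : SylvesterModuleRank R, ∀ (M : Type) [AddCommGroup M] [Module R M],
      Module.FinitePresentation R M → dim'.d M = dim.d M) := by
  refine ⟨?_, ?_, ?_⟩
  · rintro M _ _ hM ⟨α, β, hα, hβ, hlt⟩
    exact dim.d_eq_zero_of_kdimLE (hβ.2 α hlt) M hα.1
  · intro x hx _
    rw [dim.d_quotient_span_singleton_eq_zero hx, sub_zero]
  · intro dim' M _ _ hM
    obtain ⟨β, hβ⟩ := exists_hasKdim.{0} (R := R) R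
    have hbot := (bot_lt_top (α := Submodule R R)).ne'
    obtain ⟨n, hn, -⟩ := dim.exists_hasLength_d_le hβ hbot R
    obtain ⟨k, hk, -⟩ := dim.exists_hasLength_d_le hβ hbot M
    have hn0 : (n : ℝ) ≠ 0 := by
      rw [Nat.cast_ne_zero]
      rintro rfl
      exact hβ.not_isSmall hn.isSmall
    refine mul_right_cancel₀ hn0 ?_
    rw [dim'.d_mul_length hβ hn hk, dim.d_mul_length hβ hn hk]
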